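/- Under the Kepler hypotheses with 𝐥 ≠ 0, h < 0, and the orbit not circular (h ≠ −m³k²/(2l²)), let 𝐀 = A(0) be the Laplace–Runge–Lenz vector. Then for β ∈ ℝ, the function t ↦ ‖(r(t) + β² • 𝐀) × (𝐥 + β • 𝐀)‖ is constant in time if and only if β² = −1/(2mh), i.e. β = ±√(−1/(2mh)). -/

import Mathlib

open scoped RealInnerProductSpace

/-- Cross product on `EuclideanSpace ℝ (Fin 3)`. -/
noncomputable def cross3 (v w : EuclideanSpace ℝ (Fin 3)) : EuclideanSpace ℝ (Fin 3) :=
  (EuclideanSpace.equiv (Fin 3) ℝ).symm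
    (crossProduct ((EuclideanSpace.equiv (Fin 3) ℝ) v) ((EuclideanSpace.equiv (Fin 3) ℝ) w))

theorem cross3_apply_zero (v w : EuclideanSpace ℝ (Fin 3)) :
    cross3 v w 0 = v 1 * w 2 - v 2 * w 1 := by
  simp [cross3, cross_apply]

theorem cross3_apply_one (v w : EuclideanSpace ℝ (Fin 3)) :
    cross3 v w 1 = v 2 * w 0 - v 0 * w 2 := by
  simp [cross3, cross_apply]

theorem cross3_apply_two (v w : EuclideanSpace ℝ (Fin 3)) :
    cross3 v w 2 = v 0 * w 1 - v 1 * w 0 := by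
  simp [cross3, cross_apply]

theorem real_inner_fin_three (v w : EuclideanSpace ℝ (Fin 3)) :
    ⟪v, w⟫ = v 0 * w 0 + v 1 * w 1 + v 2 * w 2 := by
  simp [PiLp.inner_apply, Fin.sum_univ_three, mul_comm]

theorem euclidean_ext_fin_three {v w : EuclideanSpace ℝ (Fin 3)}
    (h₀ : v 0 = w 0) (h₁ : v 1 = w 1) (h₂ : v 2 = w 2) : v = w := by
  ext i
  fin_cases i <;> assumption

theorem norm_cross3_sq (v w : EuclideanSpace ℝ (Fin 3)) :
    ‖cross3 v w‖ ^ 2 = ‖v‖ ^ 2 * ‖w‖ ^ 2 - ⟪v, w⟫ ^ 2 := by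
  simp only [← real_inner_self_eq_norm_sq, real_inner_fin_three, cross3_apply_zero,
    cross3_apply_one, cross3_apply_two]
  ring

theorem inner_left_cross3 (v w : EuclideanSpace ℝ (Fin 3)) : ⟪v, cross3 v w⟫ = 0 := by
  simp only [real_inner_fin_three, cross3_apply_zero, cross3_apply_one, cross3_apply_two]
  ring

theorem inner_right_cross3 (v w : EuclideanSpace ℝ (Fin 3)) : ⟪w, cross3 v w⟫ = 0 := by
  simp only [real_inner_fin_three, cross3_apply_zero, cross3_apply_one, cross3_apply_two]
  ring

theorem cross3_smul_cross3 (m : ℝ) (v w : EuclideanSpace ℝ (Fin 3)) :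
    cross3 (m • v) (m • cross3 w v) = m ^ 2 • (‖v‖ ^ 2 • w - ⟪w, v⟫ • v) := by
  apply euclidean_ext_fin_three <;>
  · simp only [← real_inner_self_eq_norm_sq, real_inner_fin_three, cross3_apply_zero,
      cross3_apply_one, cross3_apply_two, PiLp.smul_apply, PiLp.sub_apply, smul_eq_mul]
    ring

theorem hasDerivAt_euclideanSpace {ι : Type*} [Fintype ι] {f : ℝ → EuclideanSpace ℝ ι}
    {f' : EuclideanSpace ℝ ι} {t : ℝ} :
    HasDerivAt f f' t ↔ ∀ i, HasDerivAt (fun s => f s i) (f' i) t := by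
  rw [← hasDerivAt_pi]
  refine ⟨fun h => ?_, fun h => ?_⟩
  · exact ((EuclideanSpace.equiv ι ℝ).hasFDerivAt (x := f t)).comp_hasDerivAt t h
  · exact ((EuclideanSpace.equiv ι ℝ).symm.hasFDerivAt (x := (f t).ofLp)).comp_hasDerivAt
      (f := fun s => (f s).ofLp) t h

theorem HasDerivAt.cross3 {f g : ℝ → EuclideanSpace ℝ (Fin 3)}
    {f' g' : EuclideanSpace ℝ (Fin 3)} {t : ℝ} (hf : HasDerivAt f f' t)
    (hg : HasDerivAt g g' t) :
    HasDerivAt (fun s => _root_.cross3 (f s) (g s))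
      (_root_.cross3 f' (g t) + _root_.cross3 (f t) g') t := by
  rw [hasDerivAt_euclideanSpace] at hf hg ⊢
  simp only [Fin.forall_fin_succ, IsEmpty.forall_iff, and_true,
    Fin.succ_zero_eq_one, Fin.succ_one_eq_two, PiLp.add_apply, cross3_apply_zero,
    cross3_apply_one, cross3_apply_two] at hf hg ⊢
  obtain ⟨hf₀, hf₁, hf₂⟩ := hf
  obtain ⟨hg₀, hg₁, hg₂⟩ := hg
  refine ⟨?_, ?_, ?_⟩
  · exact ((hf₁.fun_mul hg₂).fun_sub (hf₂.fun_mul hg₁)).congr_deriv (by ring)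
  · exact ((hf₂.fun_mul hg₀).fun_sub (hf₀.fun_mul hg₂)).congr_deriv (by ring)
  · exact ((hf₀.fun_mul hg₁).fun_sub (hf₁.fun_mul hg₀)).congr_deriv (by ring)

theorem eq_of_forall_hasDerivAt_zero {E : Type*} [NormedAddCommGroup E] [NormedSpace ℝ E]
    {f : ℝ → E} (hf : ∀ t, HasDerivAt f 0 t) (s t : ℝ) : f s = f t :=
  is_const_of_deriv_eq_zero (fun x => (hf x).differentiableAt) (fun x => (hf x).deriv) s t

/-- Conservation of angular momentum in a central force field. -/
theorem cross3_const_of_central_force {r v : ℝ → EuclideanSpace ℝ (Fin 3)} {c : ℝ → ℝ}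
    (hr : ∀ t, HasDerivAt r (v t) t) (hv : ∀ t, HasDerivAt v (c t • r t) t) (s t : ℝ) :
    cross3 (r s) (v s) = cross3 (r t) (v t) := by
  refine eq_of_forall_hasDerivAt_zero (f := fun t => cross3 (r t) (v t)) (fun x => ?_) s t
  have h : cross3 (v x) (v x) + cross3 (r x) (c x • r x) = 0 := by
    apply euclidean_ext_fin_three <;>
    · simp only [PiLp.add_apply, PiLp.zero_apply, cross3_apply_zero, cross3_apply_one,
        cross3_apply_two, PiLp.smul_apply, smul_eq_mul]
      ring
  exact h ▸ (hr x).cross3 (hv x)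

/-- Conservation of the Laplace–Runge–Lenz vector (per unit mass squared), in any real inner
product space. -/
theorem laplace_runge_lenz_const {E : Type*} [NormedAddCommGroup E] [InnerProductSpace ℝ E]
    {k : ℝ} {r v : ℝ → E} (hrne : ∀ t, r t ≠ 0) (hr : ∀ t, HasDerivAt r (v t) t)
    (hv : ∀ t, HasDerivAt v (-(k / ‖r t‖ ^ 3) • r t) t) (s t : ℝ) :
    ‖v s‖ ^ 2 • r s - ⟪r s, v s⟫ • v s - (k / ‖r s‖) • r s =
      ‖v t‖ ^ 2 • r t - ⟪r t, v t⟫ • v t - (k / ‖r t‖) • r t := by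
  refine eq_of_forall_hasDerivAt_zero
    (f := fun t => ‖v t‖ ^ 2 • r t - ⟪r t, v t⟫ • v t - (k / ‖r t‖) • r t) (fun x => ?_) s t
  have hρ : ‖r x‖ ≠ 0 := norm_ne_zero_iff.mpr (hrne x)
  have hnorm : HasDerivAt (fun t => ‖r t‖) (⟪r x, v x⟫ / ‖r x‖) x := by
    have h := (hr x).norm_sq.sqrt (pow_ne_zero 2 hρ)
    simp only [Real.sqrt_sq (norm_nonneg _)] at h
    convert h using 1
    field_simp
  have h := (((hv x).norm_sq.fun_smul (hr x)).fun_sub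
    (((hr x).inner ℝ (hv x)).fun_smul (hv x))).fun_sub
    (((hasDerivAt_const x k).fun_div hnorm hρ).fun_smul (hr x))
  refine h.congr_deriv ?_
  simp only [inner_smul_right, real_inner_self_eq_norm_sq, real_inner_comm (r x) (v x)]
  match_scalars <;> field_simp <;> ring

/-- If `R ⊥ L`, `A ⊥ L` and `⟪R, A⟫ = ‖L‖² - κ‖R‖`, `‖(R + β²A) × (L + βA)‖²` depends
on `R` only through `‖R‖²`. -/
theorem norm_cross3_add_smul_sq {R L A : EuclideanSpace ℝ (Fin 3)} {κ : ℝ} (β : ℝ)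
    (hRL : ⟪R, L⟫ = 0) (hAL : ⟪A, L⟫ = 0) (hRA : ⟪R, A⟫ = ‖L‖ ^ 2 - κ * ‖R‖) :
    ‖cross3 (R + β ^ 2 • A) (L + β • A)‖ ^ 2 =
      (‖L‖ ^ 2 + β ^ 2 * (‖A‖ ^ 2 - κ ^ 2)) * ‖R‖ ^ 2 +
        β ^ 2 * ‖L‖ ^ 2 * (‖L‖ ^ 2 + β ^ 2 * ‖A‖ ^ 2) := by
  rw [norm_cross3_sq]
  simp only [← real_inner_self_eq_norm_sq, inner_add_left, inner_add_right, real_inner_smul_left,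
    real_inner_smul_right, real_inner_comm R A, real_inner_comm A L, hRL, hAL, hRA]
  simp only [real_inner_self_eq_norm_sq]
  ring

/-- For a noncircular negative-energy Kepler orbit, the quantity
`‖(r + β²•𝐀) × (𝐥 + β•𝐀)‖` is constant in time iff `β² = −1/(2mh)`. -/
theorem kepler_orbit_cylinder_characterization
    (k m : ℝ) (hk : 0 < k) (hm : 0 < m)
    (r : ℝ → EuclideanSpace ℝ (Fin 3))
    (hr : Differentiable ℝ r) (hr' : Differentiable ℝ (deriv r))
    (hrne : ∀ t, r t ≠ 0)
    (heq : ∀ t, deriv (deriv r) t = -(k / ‖r t‖ ^ 3) • r t)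
    (L : EuclideanSpace ℝ (Fin 3)) (hL : L = m • cross3 (r 0) (deriv r 0)) (hLne : L ≠ 0)
    (l : ℝ) (hl : l = ‖L‖)
    (h : ℝ) (hh : h = m * ‖deriv r 0‖ ^ 2 / 2 - m * k / ‖r 0‖) (hhneg : h < 0)
    (hnoncirc : h ≠ -(m ^ 3 * k ^ 2) / (2 * l ^ 2))
    (A : EuclideanSpace ℝ (Fin 3))
    (hA : A = cross3 (m • deriv r 0) (m • cross3 (r 0) (deriv r 0)) - (m ^ 2 * k / ‖r 0‖) • r 0)
    (β : ℝ) :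
    (∀ t, ‖cross3 (r t + β ^ 2 • A) (L + β • A)‖ = ‖cross3 (r 0 + β ^ 2 • A) (L + β • A)‖) ↔
      β ^ 2 = -1 / (2 * m * h) := by
  have hd : ∀ t, HasDerivAt r (deriv r t) t := fun t => (hr t).hasDerivAt
  have hd' : ∀ t, HasDerivAt (deriv r) (-(k / ‖r t‖ ^ 3) • r t) t := fun t =>
    heq t ▸ (hr' t).hasDerivAt
  have hρ : ∀ t, ‖r t‖ ≠ 0 := fun t => norm_ne_zero_iff.mpr (hrne t)
  have hLt : ∀ t, L = m • cross3 (r t) (deriv r t) := fun t => by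
    rw [hL, cross3_const_of_central_force hd hd' 0 t]
  have hAt : ∀ t, A = m ^ 2 • (‖deriv r t‖ ^ 2 • r t - ⟪r t, deriv r t⟫ • deriv r t -
      (k / ‖r t‖) • r t) := fun t => by
    rw [← laplace_runge_lenz_const hrne hd hd' 0 t, hA, cross3_smul_cross3]
    module
  have hLsq : ∀ t, ‖L‖ ^ 2 =
      m ^ 2 * (‖r t‖ ^ 2 * ‖deriv r t‖ ^ 2 - ⟪r t, deriv r t⟫ ^ 2) := fun t => by
    rw [hLt t, norm_smul, mul_pow, norm_cross3_sq, Real.norm_eq_abs, sq_abs]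
  have hRL : ∀ t, ⟪r t, L⟫ = 0 := fun t => by
    rw [hLt t, real_inner_smul_right, inner_left_cross3, mul_zero]
  have hAL : ⟪A, L⟫ = 0 := by
    simp only [hLt 0, hAt 0, real_inner_smul_right, real_inner_smul_left, inner_sub_left,
      inner_left_cross3, inner_right_cross3, mul_zero, sub_zero]
  have hRA : ∀ t, ⟪r t, A⟫ = ‖L‖ ^ 2 - m ^ 2 * k * ‖r t‖ := fun t => by
    have := hρ t
    rw [hLsq t, hAt t]
    simp only [real_inner_smul_right, inner_sub_right, real_inner_self_eq_norm_sq]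
    field_simp
  have hAsq : ‖A‖ ^ 2 - (m ^ 2 * k) ^ 2 = 2 * m * h * ‖L‖ ^ 2 := by
    have := hρ 0
    rw [hLsq 0, ← real_inner_self_eq_norm_sq A, hAt 0, hh]
    simp only [real_inner_smul_left, real_inner_smul_right, inner_sub_left, inner_sub_right,
      real_inner_comm (r 0) (deriv r 0)]
    simp only [real_inner_self_eq_norm_sq]
    field_simp
    ring
  have hLpos : 0 < ‖L‖ ^ 2 := by positivity
  have hF : ∀ t, ‖cross3 (r t + β ^ 2 • A) (L + β • A)‖ ^ 2 =
      ‖L‖ ^ 2 * (1 + 2 * m * h * β ^ 2) * ‖r t‖ ^ 2 +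
        β ^ 2 * ‖L‖ ^ 2 * (‖L‖ ^ 2 + β ^ 2 * ‖A‖ ^ 2) := fun t => by
    rw [norm_cross3_add_smul_sq β (hRL t) hAL (hRA t), hAsq]
    ring
  have hβ : β ^ 2 = -1 / (2 * m * h) ↔ 1 + 2 * m * h * β ^ 2 = 0 := by
    rw [eq_div_iff (by simp [hm.ne', hhneg.ne])]
    constructor <;> intro H <;> linarith
  rw [hβ]
  constructor
  · intro H
    by_contra hne
    have hsq : ∀ t, ‖r t‖ ^ 2 = ‖r 0‖ ^ 2 := fun t => by
      have := hF t
      rw [H t, hF 0] at this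
      exact (mul_left_cancel₀ (mul_ne_zero hLpos.ne' hne) (add_right_cancel this)).symm
    have hrv : ∀ t, ⟪r t, deriv r t⟫ = 0 := fun t => by
      have h₁ := (hd t).norm_sq
      rw [funext hsq] at h₁
      linarith [h₁.unique (hasDerivAt_const t (‖r 0‖ ^ 2))]
    have hv : ‖deriv r 0‖ ^ 2 = k / ‖r 0‖ := by
      have h₁ := (hd 0).inner ℝ (hd' 0)
      rw [funext hrv] at h₁
      have h₂ := h₁.unique (hasDerivAt_const 0 (0 : ℝ))
      rw [real_inner_smul_right, real_inner_self_eq_norm_sq, real_inner_self_eq_norm_sq] at h₂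
      have := hρ 0
      field_simp at h₂ ⊢
      linarith
    apply hnoncirc
    have := hρ 0
    rw [hl, hLsq 0, hrv 0, hh, hv]
    field_simp
    ring
  · intro H t
    rw [← sq_eq_sq₀ (norm_nonneg _) (norm_nonneg _), hF t, hF 0, H]
    ring
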